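/- arXiv:1002.2651 — 2 statements merged into one kernel-verified Lean document; each statement's English description precedes it below -/
import Mathlib

section
/- Let C be an idempotent complete triangulated category and let H ⊆ C be a negative full additive subcategory. Let T be the Karoubi-closure in C of the smallest strictly full triangulated subcategory ⟨H⟩ of C containing H (T is a triangulated subcategory of C). Then there exists a unique bounded weight structure w on T such that every object of H lies in T^{w=0}, and its heart is the Karoubi-closure of H in C. -/
open CategoryTheory CategoryTheory.Limits CategoryTheory.Pretriangulated

universe v u

namespace Paper

/-- `X` is a retract of `Y`: the identity of `X` factors through `Y`. -/
def IsRetractOf {C : Type u} [Category.{v} C] (X Y : C) : Prop :=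
  ∃ (i : X ⟶ Y) (r : Y ⟶ X), i ≫ r = 𝟙 X

variable (C : Type u) [Category.{v} C] [HasZeroObject C] [Preadditive C] [HasShift C ℤ]
  [∀ n : ℤ, (shiftFunctor C n).Additive] [Pretriangulated C]

/-- A class of objects is extension-stable if for every distinguished triangle
`A ⟶ B ⟶ C'`, if `A` and `C'` lie in the class then so does `B`. -/
def ExtStable (S : Set C) : Prop :=
  ∀ T : Triangle C, T ∈ (distTriang C) → T.obj₁ ∈ S → T.obj₃ ∈ S → T.obj₂ ∈ S

/-- A weight structure on a (pre)triangulated category `C`: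
two additive, Karoubi-closed classes `le = C^{w≤0}` and `ge = C^{w≥0}` satisfying
semi-invariance with respect to translations, orthogonality, and the existence of
weight decompositions (stated in the rotated form `X ⟶ A ⟶ B ⟶ X[1]`,
equivalent to the triangle `B[-1] ⟶ X ⟶ A ⟶ B`). -/
structure WeightStructure where
  le : Set C
  ge : Set C
  le_retract : ∀ ⦃X Y : C⦄, IsRetractOf X Y → Y ∈ le → X ∈ le
  ge_retract : ∀ ⦃X Y : C⦄, IsRetractOf X Y → Y ∈ ge → X ∈ ge
  le_add : ∀ ⦃X Y : C⦄, X ∈ le → Y ∈ le →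
    ∀ b : BinaryBicone X Y, Nonempty b.IsBilimit → b.pt ∈ le
  ge_add : ∀ ⦃X Y : C⦄, X ∈ ge → Y ∈ ge →
    ∀ b : BinaryBicone X Y, Nonempty b.IsBilimit → b.pt ∈ ge
  le_shift : ∀ ⦃X : C⦄, X ∈ le → X⟦(1 : ℤ)⟧ ∈ le
  ge_shift : ∀ ⦃X : C⦄, X ∈ ge → X⟦(-1 : ℤ)⟧ ∈ ge
  orth : ∀ ⦃X Y : C⦄, X ∈ ge → Y ∈ le → ∀ f : X ⟶ Y⟦(1 : ℤ)⟧, f = 0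
  decomp : ∀ X : C, ∃ (A B : C) (f : X ⟶ A) (g : A ⟶ B) (h : B ⟶ X⟦(1 : ℤ)⟧),
    A ∈ le ∧ B ∈ ge ∧ Triangle.mk f g h ∈ distTriang C

variable {C}

/-- `C^{w≤i} = C^{w≤0}[-i]`: the objects `X` with `X⟦i⟧ ∈ C^{w≤0}`. -/
def WeightStructure.leSet (w : WeightStructure C) (i : ℤ) : Set C := {X | X⟦i⟧ ∈ w.le}

/-- `C^{w≥i} = C^{w≥0}[-i]`: the objects `X` with `X⟦i⟧ ∈ C^{w≥0}`. -/
def WeightStructure.geSet (w : WeightStructure C) (i : ℤ) : Set C := {X | X⟦i⟧ ∈ w.ge}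

/-- The heart `C^{w=0} = C^{w≤0} ∩ C^{w≥0}` of a weight structure. -/
def WeightStructure.heart (w : WeightStructure C) : Set C := w.le ∩ w.ge

/-- `C^{w=i} = C^{w≥i} ∩ C^{w≤i}`. -/
def WeightStructure.eqSet (w : WeightStructure C) (i : ℤ) : Set C := w.geSet i ∩ w.leSet i

/-- `C^{[i,j]} = C^{w≥i} ∩ C^{w≤j}`. -/
def WeightStructure.interval (w : WeightStructure C) (i j : ℤ) : Set C :=
  w.geSet i ∩ w.leSet j

/-- A weight structure is bounded if `⋃ᵢ C^{w≤i} = Obj C = ⋃ᵢ C^{w≥i}`. -/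
def WeightStructure.Bounded (w : WeightStructure C) : Prop :=
  ∀ X : C, (∃ i : ℤ, X ∈ w.leSet i) ∧ (∃ j : ℤ, X ∈ w.geSet j)

/-- A class of objects is negative: `Hom(X, Y[i]) = 0` for all its objects `X, Y`
and all `i > 0`. -/
def Negative (H : Set C) : Prop :=
  ∀ X ∈ H, ∀ Y ∈ H, ∀ i : ℤ, 0 < i → ∀ f : X ⟶ Y⟦i⟧, f = 0

/-- A class of objects is additive: it contains the zero objects and is closed
under binary direct sums. -/
def AdditiveClass (H : Set C) : Prop :=
  (∀ ⦃Z : C⦄, IsZero Z → Z ∈ H) ∧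
  (∀ ⦃X Y : C⦄, X ∈ H → Y ∈ H → ∀ b : BinaryBicone X Y, Nonempty b.IsBilimit → b.pt ∈ H)

/-- A class of objects forms a strictly full triangulated subcategory. -/
def IsTriangClosed (S : Set C) : Prop :=
  (∀ ⦃Z : C⦄, IsZero Z → Z ∈ S) ∧
  (∀ ⦃X Y : C⦄, (X ≅ Y) → X ∈ S → Y ∈ S) ∧
  (∀ ⦃X : C⦄, X ∈ S → ∀ n : ℤ, X⟦n⟧ ∈ S) ∧
  ExtStable C S

/-- `⟨H⟩`: the class of objects of the smallest strictly full triangulated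
subcategory containing `H`. -/
def triangClosure (H : Set C) : Set C := ⋂₀ {S : Set C | IsTriangClosed S ∧ H ⊆ S}

/-- The Karoubi-closure of a class `H`: all retracts (in the ambient category) of
objects of `H`. -/
def retractClosure (H : Set C) : Set C := {X | ∃ Y ∈ H, IsRetractOf X Y}

/-- The pair `(le, ge)` is a weight structure on the (strictly full triangulated)
subcategory of `C` whose objects form the class `T`. -/
def IsWeightStructureOn (T le ge : Set C) : Prop :=
  le ⊆ T ∧ ge ⊆ T ∧
  (∀ ⦃X Y : C⦄, X ∈ T → IsRetractOf X Y → Y ∈ le → X ∈ le) ∧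
  (∀ ⦃X Y : C⦄, X ∈ T → IsRetractOf X Y → Y ∈ ge → X ∈ ge) ∧
  (∀ ⦃X Y : C⦄, X ∈ le → Y ∈ le →
    ∀ b : BinaryBicone X Y, Nonempty b.IsBilimit → b.pt ∈ T → b.pt ∈ le) ∧
  (∀ ⦃X Y : C⦄, X ∈ ge → Y ∈ ge →
    ∀ b : BinaryBicone X Y, Nonempty b.IsBilimit → b.pt ∈ T → b.pt ∈ ge) ∧
  (∀ ⦃X : C⦄, X ∈ le → X⟦(1 : ℤ)⟧ ∈ le) ∧
  (∀ ⦃X : C⦄, X ∈ ge → X⟦(-1 : ℤ)⟧ ∈ ge) ∧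
  (∀ ⦃X Y : C⦄, X ∈ ge → Y ∈ le → ∀ f : X ⟶ Y⟦(1 : ℤ)⟧, f = 0) ∧
  (∀ X, X ∈ T → ∃ (A B : C) (f : X ⟶ A) (g : A ⟶ B) (h : B ⟶ X⟦(1 : ℤ)⟧),
    A ∈ le ∧ B ∈ ge ∧ Triangle.mk f g h ∈ distTriang C)

/-- The weight structure `(le, ge)` on the subcategory with objects `T` is bounded. -/
def BoundedOn (T le ge : Set C) : Prop :=
  ∀ X ∈ T, (∃ i : ℤ, X⟦i⟧ ∈ le) ∧ (∃ j : ℤ, X⟦j⟧ ∈ ge)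

set_option linter.unusedSectionVars false

/-- All morphisms from `X` to `Y` vanish. -/
def HomVanish (X Y : C) : Prop := ∀ f : X ⟶ Y, f = 0

namespace HomVanish

lemma of_retract_left {X X' Y : C} (h : HomVanish X Y) (hX : IsRetractOf X' X) :
    HomVanish X' Y := fun f => by
  obtain ⟨i, r, hir⟩ := hX
  rw [← Category.id_comp f, ← hir, Category.assoc, h (r ≫ f), comp_zero]

lemma of_retract_right {X Y Y' : C} (h : HomVanish X Y) (hY : IsRetractOf Y' Y) :
    HomVanish X Y' := fun f => by
  obtain ⟨i, r, hir⟩ := hY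
  rw [← Category.comp_id f, ← hir, ← Category.assoc, h (f ≫ i), zero_comp]

lemma of_iso_left {X X' Y : C} (h : HomVanish X Y) (e : X' ≅ X) : HomVanish X' Y :=
  h.of_retract_left ⟨e.hom, e.inv, e.hom_inv_id⟩

lemma of_iso_right {X Y Y' : C} (h : HomVanish X Y) (e : Y' ≅ Y) : HomVanish X Y' :=
  h.of_retract_right ⟨e.hom, e.inv, e.hom_inv_id⟩

lemma shift {X Y : C} (h : HomVanish X Y) (n : ℤ) : HomVanish (X⟦n⟧) (Y⟦n⟧) := fun f => by
  obtain ⟨g, rfl⟩ := (shiftFunctor C n).map_surjective f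
  rw [h g, Functor.map_zero]

/-- `Hom(X, Y⟦c⟧) = 0` implies `Hom(X⟦a⟧, Y⟦b⟧) = 0` when `c + a = b`. -/
lemma shift_left {X Y : C} {c : ℤ} (h : HomVanish X (Y⟦c⟧)) (a b : ℤ) (hab : c + a = b) :
    HomVanish (X⟦a⟧) (Y⟦b⟧) :=
  (h.shift a).of_iso_right ((shiftFunctorAdd' C c a b hab).app Y)

lemma shift_right {X Y : C} {c : ℤ} (h : HomVanish X (Y⟦c⟧)) (a b : ℤ) (hab : a + b = c) :
    HomVanish X (Y⟦a⟧⟦b⟧) :=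
  h.of_iso_right ((shiftFunctorAdd' C a b c hab).app Y).symm

lemma unshift_right {X Y : C} {a b : ℤ} (h : HomVanish X (Y⟦a⟧⟦b⟧)) (c : ℤ) (hab : a + b = c) :
    HomVanish X (Y⟦c⟧) :=
  h.of_iso_right ((shiftFunctorAdd' C a b c hab).app Y)

lemma ext_right {X : C} {T : Triangle C} (hT : T ∈ distTriang C) (h₁ : HomVanish X T.obj₁)
    (h₃ : HomVanish X T.obj₃) : HomVanish X T.obj₂ := fun f => by
  obtain ⟨g, hg⟩ := Triangle.coyoneda_exact₂ T hT f (h₃ _)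
  rw [hg, h₁ g, zero_comp]

lemma ext_left {Y : C} {T : Triangle C} (hT : T ∈ distTriang C) (h₁ : HomVanish T.obj₁ Y)
    (h₃ : HomVanish T.obj₃ Y) : HomVanish T.obj₂ Y := fun f => by
  obtain ⟨g, hg⟩ := Triangle.yoneda_exact₂ T hT f (h₁ _)
  rw [hg, h₃ g, comp_zero]

lemma ext_right_shift {X : C} {T : Triangle C} (hT : T ∈ distTriang C) (n : ℤ)
    (h₁ : HomVanish X (T.obj₁⟦n⟧)) (h₃ : HomVanish X (T.obj₃⟦n⟧)) :
    HomVanish X (T.obj₂⟦n⟧) :=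
  ext_right (Triangle.shift_distinguished T hT n) h₁ h₃

lemma biprod_left {X₁ X₂ Y : C} (h₁ : HomVanish X₁ Y) (h₂ : HomVanish X₂ Y)
    (b : BinaryBicone X₁ X₂) (hb : b.IsBilimit) : HomVanish b.pt Y := fun _ =>
  BinaryCofan.IsColimit.hom_ext hb.isColimit ((h₁ _).trans (h₁ _).symm)
    ((h₂ _).trans (h₂ _).symm)

lemma biprod_right {X Y₁ Y₂ : C} (h₁ : HomVanish X Y₁) (h₂ : HomVanish X Y₂)
    (b : BinaryBicone Y₁ Y₂) (hb : b.IsBilimit) : HomVanish X b.pt := fun _ =>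
  BinaryFan.IsLimit.hom_ext hb.isLimit ((h₁ _).trans (h₁ _).symm)
    ((h₂ _).trans (h₂ _).symm)

lemma biprod_right_shift {X Y₁ Y₂ : C} (n : ℤ) (h₁ : HomVanish X (Y₁⟦n⟧))
    (h₂ : HomVanish X (Y₂⟦n⟧)) (b : BinaryBicone Y₁ Y₂) (hb : b.IsBilimit) :
    HomVanish X (b.pt⟦n⟧) :=
  have := preservesBinaryBiproducts_of_preservesBiproducts (shiftFunctor C n)
  h₁.biprod_right h₂ ((shiftFunctor C n).mapBinaryBicone b)
    (isBinaryBilimitOfPreserves (shiftFunctor C n) hb)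

/-- If the cones of the outer components of a morphism of distinguished triangles admit no
nonzero morphism to `W`, then neither does any cone of the middle component. -/
lemma cone_of_morphism {X Y Z A₁ A₂ A₃ B₁ B₂ B₃ W : C}
    {u : X ⟶ Y} {v : Y ⟶ Z} {w : Z ⟶ X⟦(1 : ℤ)⟧} (hX : Triangle.mk u v w ∈ distTriang C)
    {u' : A₁ ⟶ A₂} {v' : A₂ ⟶ A₃} {w' : A₃ ⟶ A₁⟦(1 : ℤ)⟧}
    (hA : Triangle.mk u' v' w' ∈ distTriang C)
    {a₁ : X ⟶ A₁} {b₁ : A₁ ⟶ B₁} {c₁ : B₁ ⟶ X⟦(1 : ℤ)⟧}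
    (h₁ : Triangle.mk a₁ b₁ c₁ ∈ distTriang C)
    {a₂ : Y ⟶ A₂} {b₂ : A₂ ⟶ B₂} {c₂ : B₂ ⟶ Y⟦(1 : ℤ)⟧}
    (h₂ : Triangle.mk a₂ b₂ c₂ ∈ distTriang C)
    {a₃ : Z ⟶ A₃} {b₃ : A₃ ⟶ B₃} {c₃ : B₃ ⟶ Z⟦(1 : ℤ)⟧}
    (h₃ : Triangle.mk a₃ b₃ c₃ ∈ distTriang C)
    (hu : u ≫ a₂ = a₁ ≫ u') (hv : v ≫ a₃ = a₂ ≫ v') (hw : w ≫ a₁⟦(1 : ℤ)⟧' = a₃ ≫ w')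
    (hB₁ : HomVanish B₁ W) (hB₃ : HomVanish B₃ W) : HomVanish B₂ W := by
  have inj {X A B : C} {a : X ⟶ A} {b : A ⟶ B} {c : B ⟶ X⟦(1 : ℤ)⟧}
      (h : Triangle.mk a b c ∈ distTriang C) (hB : HomVanish B W) (k : A ⟶ W)
      (hk : a ≫ k = 0) : k = 0 := by
    obtain ⟨g, hg⟩ : ∃ g : B ⟶ W, k = b ≫ g := Triangle.yoneda_exact₂ _ h k hk
    rw [hg, hB g, comp_zero]
  have surj {X A B : C} {a : X ⟶ A} {b : A ⟶ B} {c : B ⟶ X⟦(1 : ℤ)⟧}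
      (h : Triangle.mk a b c ∈ distTriang C) (hB : HomVanish B W) (m : X⟦(1 : ℤ)⟧ ⟶ W) :
      ∃ m' : A⟦(1 : ℤ)⟧ ⟶ W, m = a⟦(1 : ℤ)⟧' ≫ m' := by
    obtain ⟨g, hg⟩ := Triangle.yoneda_exact₃ _ (rot_of_distTriang _ h) m (hB _)
    exact ⟨-g, hg.trans ((Preadditive.neg_comp _ _).trans (Preadditive.comp_neg _ _).symm)⟩
  have exact₁ {X Y Z : C} {u : X ⟶ Y} {v : Y ⟶ Z} {w : Z ⟶ X⟦(1 : ℤ)⟧}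
      (h : Triangle.mk u v w ∈ distTriang C) (m : X⟦(1 : ℤ)⟧ ⟶ W) (hm : w ≫ m = 0) :
      ∃ m' : Y⟦(1 : ℤ)⟧ ⟶ W, m = u⟦(1 : ℤ)⟧' ≫ m' := by
    obtain ⟨g, hg⟩ := Triangle.yoneda_exact₃ _ (rot_of_distTriang _ h) m hm
    exact ⟨-g, hg.trans ((Preadditive.neg_comp _ _).trans (Preadditive.comp_neg _ _).symm)⟩
  have exact₂ {X Y Z : C} {u : X ⟶ Y} {v : Y ⟶ Z} {w : Z ⟶ X⟦(1 : ℤ)⟧}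
      (h : Triangle.mk u v w ∈ distTriang C) (m : Y⟦(1 : ℤ)⟧ ⟶ W)
      (hm : u⟦(1 : ℤ)⟧' ≫ m = 0) : ∃ m' : Z⟦(1 : ℤ)⟧ ⟶ W, m = v⟦(1 : ℤ)⟧' ≫ m' := by
    obtain ⟨g, hg⟩ := Triangle.yoneda_exact₃ _
      (rot_of_distTriang _ (rot_of_distTriang _ h)) m
      ((Preadditive.neg_comp _ _).trans (neg_eq_zero.2 hm))
    exact ⟨-g, hg.trans ((Preadditive.neg_comp _ _).trans (Preadditive.comp_neg _ _).symm)⟩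
  have inj₂ (k : A₂ ⟶ W) (hk : a₂ ≫ k = 0) : k = 0 := by
    have hu'k : u' ≫ k = 0 := inj h₁ hB₁ _ (by
      rw [← Category.assoc, ← hu, Category.assoc, hk, comp_zero])
    obtain ⟨k₃, hk₃⟩ : ∃ k₃ : A₃ ⟶ W, k = v' ≫ k₃ := Triangle.yoneda_exact₂ _ hA k hu'k
    obtain ⟨m, hm⟩ : ∃ m : X⟦(1 : ℤ)⟧ ⟶ W, a₃ ≫ k₃ = w ≫ m :=
      Triangle.yoneda_exact₃ _ hX (a₃ ≫ k₃) (by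
        change v ≫ a₃ ≫ k₃ = 0
        rw [← Category.assoc, hv, Category.assoc, ← hk₃, hk])
    obtain ⟨m', rfl⟩ := surj h₁ hB₁ m
    have hk₃' : k₃ - w' ≫ m' = 0 := inj h₃ hB₃ _ (by
      rw [Preadditive.comp_sub, hm, ← Category.assoc, ← Category.assoc, hw, sub_self])
    have hv'w' : v' ≫ w' = 0 := comp_distTriang_mor_zero₂₃ _ hA
    rw [hk₃, sub_eq_zero.1 hk₃', ← Category.assoc, hv'w', zero_comp]
  intro f
  obtain ⟨m, rfl⟩ : ∃ m : Y⟦(1 : ℤ)⟧ ⟶ W, f = c₂ ≫ m :=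
    Triangle.yoneda_exact₃ _ h₂ f (inj₂ _ (by
      have : a₂ ≫ b₂ = 0 := comp_distTriang_mor_zero₁₂ _ h₂
      change a₂ ≫ b₂ ≫ f = 0
      rw [← Category.assoc, this, zero_comp]))
  obtain ⟨m₁, hm₁⟩ := surj h₁ hB₁ (u⟦(1 : ℤ)⟧' ≫ m)
  have hw'm₁ : w' ≫ m₁ = 0 := inj h₃ hB₃ _ (by
    have : w ≫ u⟦(1 : ℤ)⟧' = 0 := comp_distTriang_mor_zero₃₁ _ hX
    rw [← Category.assoc, ← hw, Category.assoc, ← hm₁, ← Category.assoc, this, zero_comp])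
  obtain ⟨m₂, rfl⟩ := exact₁ hA m₁ hw'm₁
  obtain ⟨m₃, hm₃⟩ := exact₂ hX (m - a₂⟦(1 : ℤ)⟧' ≫ m₂) (by
    rw [Preadditive.comp_sub, hm₁, ← Category.assoc, ← Category.assoc, ← Functor.map_comp,
      ← Functor.map_comp, hu, sub_self])
  obtain ⟨m₄, rfl⟩ := surj h₃ hB₃ m₃
  have hm : m = a₂⟦(1 : ℤ)⟧' ≫ (m₂ + v'⟦(1 : ℤ)⟧' ≫ m₄) := by
    rw [sub_eq_iff_eq_add.1 hm₃, Preadditive.comp_add, add_comm, ← Category.assoc,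
      ← Category.assoc, ← Functor.map_comp, ← Functor.map_comp, hv]
  have hc₂ : c₂ ≫ a₂⟦(1 : ℤ)⟧' = 0 := comp_distTriang_mor_zero₃₁ _ h₂
  rw [hm, ← Category.assoc, hc₂, zero_comp]

end HomVanish

lemma IsRetractOf.map {X Y : C} (h : IsRetractOf X Y) {D : Type*} [Category D] (F : C ⥤ D) :
    IsRetractOf (F.obj X) (F.obj Y) := by
  obtain ⟨i, r, hir⟩ := h
  exact ⟨F.map i, F.map r, by rw [← F.map_comp, hir, F.map_id]⟩

lemma IsRetractOf.trans {X Y Z : C} (h : IsRetractOf X Y) (h' : IsRetractOf Y Z) :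
    IsRetractOf X Z := by
  obtain ⟨i, r, hir⟩ := h
  obtain ⟨i', r', hir'⟩ := h'
  exact ⟨i ≫ i', r' ≫ r, by rw [Category.assoc, ← Category.assoc i', hir', Category.id_comp, hir]⟩

lemma IsRetractOf.refl (X : C) : IsRetractOf X X := ⟨𝟙 X, 𝟙 X, Category.comp_id _⟩

/-- Two distinguished triangles have a direct sum, here described on objects only. -/
lemma exists_distTriang_biprod {T₁ T₂ : Triangle C} (h₁ : T₁ ∈ distTriang C)
    (h₂ : T₂ ∈ distTriang C) : ∃ T ∈ distTriang C, Nonempty (T.obj₁ ≅ T₁.obj₁ ⊞ T₂.obj₁) ∧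
      Nonempty (T.obj₂ ≅ T₁.obj₂ ⊞ T₂.obj₂) ∧ Nonempty (T.obj₃ ≅ T₁.obj₃ ⊞ T₂.obj₃) := by
  have key (F : WalkingPair → C) :
      Nonempty ((∏ᶜ F) ≅ F WalkingPair.left ⊞ F WalkingPair.right) :=
    ⟨{ hom := biprod.lift (Pi.π F _) (Pi.π F _)
       inv := Pi.lift (fun j => match j with
        | WalkingPair.left => biprod.fst
        | WalkingPair.right => biprod.snd)
       hom_inv_id := by
         refine Pi.hom_ext _ _ (fun j => ?_)
         cases j <;> simp
       inv_hom_id := by ext <;> simp }⟩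
  exact ⟨_, productTriangle_distinguished
    (fun j : WalkingPair => match j with
      | WalkingPair.left => T₁
      | WalkingPair.right => T₂) (by rintro (_ | _) <;> assumption), key _, key _, key _⟩

namespace IsTriangClosed

variable {S : Set C}

lemma cone_mem (hS : IsTriangClosed S) {T : Triangle C} (hT : T ∈ distTriang C)
    (h₁ : T.obj₁ ∈ S) (h₂ : T.obj₂ ∈ S) : T.obj₃ ∈ S :=
  hS.2.2.2 T.rotate (rot_of_distTriang _ hT) h₂ (hS.2.2.1 h₁ 1)

lemma biprod_mem_of_biprod_mem (hS : IsTriangClosed S) {P Q R : C} (h₁ : (P ⊞ Q : C) ∈ S)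
    (h₂ : (Q⟦(1 : ℤ)⟧ ⊞ R : C) ∈ S) : (P ⊞ R : C) ∈ S := by
  obtain ⟨Z, f, g, hZ⟩ := distinguished_cocone_triangle (0 : Q ⟶ R)
  obtain ⟨e, -⟩ := exists_iso_binaryBiproduct_of_distTriang _ (rot_of_distTriang _ hZ)
    (neg_eq_zero.2 (Functor.map_zero _ _ _))
  obtain ⟨T, hT, ⟨e₁⟩, ⟨e₂⟩, ⟨e₃⟩⟩ :=
    exists_distTriang_biprod (contractible_distinguished P) hZ
  refine hS.2.1 e₂ (hS.2.2.2 T hT (hS.2.1 e₁.symm h₁) (hS.2.1 ?_ h₂))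
  exact biprod.braiding _ _ ≪≫ e.symm ≪≫ (isoZeroBiprod (isZero_zero C)) ≪≫ e₃.symm

lemma biprod_shift_mem (hS : IsTriangClosed S) {P Q : C} (h : (P ⊞ Q : C) ∈ S) (n : ℤ) :
    (P⟦n⟧ ⊞ Q⟦n⟧ : C) ∈ S :=
  have := preservesBinaryBiproducts_of_preservesBiproducts (shiftFunctor C n)
  hS.2.1 ((shiftFunctor C n).mapBiprod P Q) (hS.2.2.1 h n)

/-- A retract of an object of `S` becomes an object of `S` after adding some of its own
shifts, which can be chosen arbitrarily high. -/
lemma biprod_shift_mem_of_retract (hS : IsTriangClosed S) {X Y : C} (hXY : IsRetractOf X Y)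
    (hY : Y ∈ S) (k : ℕ) : (X ⊞ X⟦(2 * k + 1 : ℤ)⟧ : C) ∈ S := by
  obtain ⟨i, r, hir⟩ := hXY
  have base : (X ⊞ X⟦(1 : ℤ)⟧ : C) ∈ S := by
    obtain ⟨X', p, q, hT⟩ := distinguished_cocone_triangle i
    have : Mono i := ⟨fun a b hab => by
      rw [← Category.comp_id a, ← Category.comp_id b, ← hir, ← Category.assoc, hab,
        Category.assoc]⟩
    obtain ⟨e, -⟩ := exists_iso_binaryBiproduct_of_distTriang _ hT
      (Triangle.mor₃_eq_zero_of_mono₁ _ hT this)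
    have h : (X ⊞ X' : C) ∈ S := hS.2.1 e hY
    exact hS.biprod_mem_of_biprod_mem h
      (hS.biprod_shift_mem (hS.2.1 (biprod.braiding X X') h) 1)
  induction k with
  | zero => simpa using base
  | succ k ih =>
    refine hS.biprod_mem_of_biprod_mem ih (hS.2.1 ?_ (hS.biprod_shift_mem base (2 * k + 2)))
    exact biprod.mapIso ((shiftFunctorAdd' C _ _ _ (by ring)).app X)
      ((shiftFunctorAdd' C _ _ _ (by push_cast; ring)).app X).symm

end IsTriangClosed

lemma isTriangClosed_triangClosure (H : Set C) : IsTriangClosed (triangClosure H) :=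
  ⟨fun _ hZ _ hS => hS.1.1 hZ, fun _ _ e hX _ hS => hS.1.2.1 e (hX _ hS),
    fun _ hX n _ hS => hS.1.2.2.1 (hX _ hS) n,
    fun T hT h₁ h₃ _ hS => hS.1.2.2.2 T hT (h₁ _ hS) (h₃ _ hS)⟩

lemma subset_triangClosure (H : Set C) : H ⊆ triangClosure H := fun _ hX _ hS => hS.2 hX

lemma triangClosure_subset {H S : Set C} (hS : IsTriangClosed S) (hHS : H ⊆ S) :
    triangClosure H ⊆ S := fun _ hX => hX S ⟨hS, hHS⟩

lemma subset_retractClosure (H : Set C) : H ⊆ retractClosure H :=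
  fun X hX => ⟨X, hX, IsRetractOf.refl X⟩

lemma retractClosure_of_retract {H : Set C} {X Y : C} (h : IsRetractOf X Y)
    (hY : Y ∈ retractClosure H) : X ∈ retractClosure H := by
  obtain ⟨Z, hZ, hYZ⟩ := hY
  exact ⟨Z, hZ, h.trans hYZ⟩

lemma retractClosure_shift {S : Set C} (hS : IsTriangClosed S) {X : C}
    (hX : X ∈ retractClosure S) (n : ℤ) : X⟦n⟧ ∈ retractClosure S := by
  obtain ⟨Y, hY, hXY⟩ := hX
  exact ⟨Y⟦n⟧, hS.2.2.1 hY n, hXY.map (shiftFunctor C n)⟩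

/-- The objects of the Karoubi-closure of `⟨H⟩` without nonzero morphisms to the positive
shifts of objects of `H`. -/
def weightGE (H : Set C) : Set C :=
  {B | B ∈ retractClosure (triangClosure H) ∧
    ∀ Y ∈ H, ∀ j : ℤ, 0 < j → HomVanish B (Y⟦j⟧)}

/-- The objects of the Karoubi-closure of `⟨H⟩` whose positive shifts receive no nonzero
morphism from `weightGE H`. -/
def weightLE (H : Set C) : Set C :=
  {A | A ∈ retractClosure (triangClosure H) ∧
    ∀ B ∈ weightGE H, ∀ j : ℤ, 0 < j → HomVanish B (A⟦j⟧)}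

/-- `A` receives a morphism from an object of `H` through which every morphism from an object
of `weightGE H` to `A` factors. -/
def HasHeartCover (H : Set C) (A : C) : Prop :=
  ∃ Y ∈ H, ∃ p : Y ⟶ A, ∀ B ∈ weightGE H, ∀ f : B ⟶ A, ∃ g : B ⟶ Y, g ≫ p = f

/-- `X` has a weight decomposition with both terms in `S`, and whose term in `weightLE H`
has a heart cover. -/
def HasDecomp (H S : Set C) (X : C) : Prop :=
  ∃ (A B : C) (f : X ⟶ A) (g : A ⟶ B) (h : B ⟶ X⟦(1 : ℤ)⟧),
    A ∈ S ∧ A ∈ weightLE H ∧ HasHeartCover H A ∧ B ∈ S ∧ B ∈ weightGE H ∧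
      Triangle.mk f g h ∈ distTriang C

section

open ZeroObject

variable {H : Set C}

lemma mem_retractClosure_triangClosure {X : C} (hX : X ∈ H) :
    X ∈ retractClosure (triangClosure H) :=
  subset_retractClosure _ (subset_triangClosure H hX)

lemma shift_mem_weightGE (hneg : Negative H) {X : C} (hX : X ∈ H) {n : ℤ} (hn : n ≤ 0) :
    X⟦n⟧ ∈ weightGE H :=
  ⟨retractClosure_shift (isTriangClosed_triangClosure H) (mem_retractClosure_triangClosure hX) n,
    fun Y hY j hj => HomVanish.shift_left (c := j - n) (hneg X hX Y hY _ (by lia)) n j (by ring)⟩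

lemma subset_weightGE (hneg : Negative H) : H ⊆ weightGE H := fun X hX =>
  ⟨mem_retractClosure_triangClosure hX, fun Y hY j hj => hneg X hX Y hY j hj⟩

lemma shift_mem_weightLE {X : C} (hX : X ∈ H) {n : ℤ} (hn : 0 ≤ n) : X⟦n⟧ ∈ weightLE H :=
  ⟨retractClosure_shift (isTriangClosed_triangClosure H) (mem_retractClosure_triangClosure hX) n,
    fun _ hB j hj => (hB.2 X hX (n + j) (by lia)).shift_right n j rfl⟩

lemma subset_weightLE : H ⊆ weightLE H := fun X hX =>
  ⟨mem_retractClosure_triangClosure hX, fun _ hB j hj => hB.2 X hX j hj⟩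

lemma weightGE_of_retract {X Y : C} (h : IsRetractOf X Y) (hY : Y ∈ weightGE H) :
    X ∈ weightGE H :=
  ⟨retractClosure_of_retract h hY.1, fun Z hZ j hj => (hY.2 Z hZ j hj).of_retract_left h⟩

lemma weightLE_of_retract {X Y : C} (h : IsRetractOf X Y) (hY : Y ∈ weightLE H) :
    X ∈ weightLE H :=
  ⟨retractClosure_of_retract h hY.1,
    fun B hB j hj => (hY.2 B hB j hj).of_retract_right (h.map (shiftFunctor C j))⟩

lemma weightGE_shift {X : C} (hX : X ∈ weightGE H) : X⟦(-1 : ℤ)⟧ ∈ weightGE H :=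
  ⟨retractClosure_shift (isTriangClosed_triangClosure H) hX.1 _, fun Y hY j hj =>
    (hX.2 Y hY (j + 1) (by lia)).shift_left (-1) j (by ring)⟩

lemma weightLE_shift {X : C} (hX : X ∈ weightLE H) {n : ℤ} (hn : 0 ≤ n) :
    X⟦n⟧ ∈ weightLE H :=
  ⟨retractClosure_shift (isTriangClosed_triangClosure H) hX.1 _, fun B hB j hj =>
    (hX.2 B hB (n + j) (by lia)).shift_right n j rfl⟩

lemma HasHeartCover.of_retract {A A' : C} (hA : HasHeartCover H A) (h : IsRetractOf A' A) :
    HasHeartCover H A' := by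
  obtain ⟨Y, hY, p, hp⟩ := hA
  obtain ⟨i, r, hir⟩ := h
  refine ⟨Y, hY, p ≫ r, fun B hB f => ?_⟩
  obtain ⟨g, hg⟩ := hp B hB (f ≫ i)
  exact ⟨g, by rw [← Category.assoc, hg, Category.assoc, hir, Category.comp_id]⟩

lemma HasHeartCover.ext (hadd : AdditiveClass H) (hneg : Negative H)
    {A₁ A₂ A₃ : C} {u : A₁ ⟶ A₂} {v : A₂ ⟶ A₃} {w : A₃ ⟶ A₁⟦(1 : ℤ)⟧}
    (hA : Triangle.mk u v w ∈ distTriang C) (hA₁ : A₁ ∈ weightLE H)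
    (h₁ : HasHeartCover H A₁) (h₃ : HasHeartCover H A₃) : HasHeartCover H A₂ := by
  obtain ⟨Y₁, hY₁, p₁, hp₁⟩ := h₁
  obtain ⟨Y₃, hY₃, p₃, hp₃⟩ := h₃
  obtain ⟨q, hq⟩ : ∃ q : Y₃ ⟶ A₂, p₃ = q ≫ v := Triangle.coyoneda_exact₃ _ hA p₃
    (hA₁.2 Y₃ (subset_weightGE hneg hY₃) 1 one_pos _)
  refine ⟨Y₁ ⊞ Y₃, hadd.2 hY₁ hY₃ _ ⟨BinaryBiproduct.isBilimit Y₁ Y₃⟩,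
    biprod.desc (p₁ ≫ u) q, fun B hB f => ?_⟩
  obtain ⟨g₃, hg₃⟩ := hp₃ B hB (f ≫ v)
  obtain ⟨k, hk⟩ : ∃ k : B ⟶ A₁, f - g₃ ≫ q = k ≫ u := Triangle.coyoneda_exact₂ _ hA _ (by
    change (f - g₃ ≫ q) ≫ v = 0
    rw [Preadditive.sub_comp, Category.assoc, ← hq, hg₃, sub_self])
  obtain ⟨g₁, hg₁⟩ := hp₁ B hB k
  exact ⟨biprod.lift g₁ g₃, by
    rw [biprod.lift_desc, ← Category.assoc, hg₁, ← hk, sub_add_cancel]⟩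

lemma hasHeartCover_of_forall_homVanish (hadd : AdditiveClass H) {A : C}
    (hA : ∀ B ∈ weightGE H, HomVanish B A) : HasHeartCover H A :=
  ⟨0, hadd.1 (isZero_zero C), 0, fun B hB f => ⟨0, by rw [hA B hB f, zero_comp]⟩⟩

lemma hasDecomp_shift_of_mem (hadd : AdditiveClass H) (hneg : Negative H) {X : C}
    (hX : X ∈ H) (n : ℤ) : HasDecomp H (triangClosure H) (X⟦n⟧) := by
  have hS := isTriangClosed_triangClosure H
  have h0 : (0 : C) ∈ H := hadd.1 (isZero_zero C)
  have hXS := subset_triangClosure H hX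
  rcases le_or_gt 0 n with hn | hn
  · refine ⟨X⟦n⟧, 0, 𝟙 _, 0, 0, hS.2.2.1 hXS n, shift_mem_weightLE hX hn, ?_,
      hS.1 (isZero_zero C), subset_weightGE hneg h0, contractible_distinguished _⟩
    rcases hn.eq_or_lt with rfl | hn
    · refine ⟨X, hX, (shiftFunctorZero C ℤ).inv.app X, fun B _ f =>
        ⟨f ≫ (shiftFunctorZero C ℤ).hom.app X, ?_⟩⟩
      rw [Category.assoc, Iso.hom_inv_id_app]
      exact Category.comp_id f
    · exact hasHeartCover_of_forall_homVanish hadd fun B hB => hB.2 X hX n hn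
  · refine ⟨0, X⟦n⟧⟦(1 : ℤ)⟧, 0, 0, 𝟙 _, hS.1 (isZero_zero C), subset_weightLE h0,
      hasHeartCover_of_forall_homVanish hadd fun _ _ f => (isZero_zero C).eq_of_tgt _ _,
      hS.2.2.1 (hS.2.2.1 hXS n) 1, ?_, contractible_distinguished₂ _⟩
    let e := (shiftFunctorAdd' C n 1 (n + 1) rfl).app X
    exact weightGE_of_retract ⟨e.inv, e.hom, e.inv_hom_id⟩
      (shift_mem_weightGE hneg hX (by lia))

lemma HasDecomp.ext (hadd : AdditiveClass H) (hneg : Negative H)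
    {T : Triangle C} (hT : T ∈ distTriang C)
    (hY : T.obj₂ ∈ triangClosure H) (h₁ : HasDecomp H (triangClosure H) T.obj₁)
    (h₃ : HasDecomp H (triangClosure H) T.obj₃) :
    HasDecomp H (triangClosure H) T.obj₂ := by
  have hS := isTriangClosed_triangClosure H
  obtain ⟨A₁, B₁, a₁, b₁, c₁, hA₁S, hA₁, hA₁c, -, hB₁, hT₁⟩ := h₁
  obtain ⟨A₃, B₃, a₃, b₃, c₃, hA₃S, hA₃, hA₃c, -, hB₃, hT₃⟩ := h₃
  obtain ⟨w', hw'⟩ : ∃ w' : A₃ ⟶ A₁⟦(1 : ℤ)⟧, T.mor₃ ≫ a₁⟦(1 : ℤ)⟧' = a₃ ≫ w' :=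
    Triangle.yoneda_exact₂ _ (inv_rot_of_distTriang _ hT₃) _
      (hA₁.2 _ (weightGE_shift hB₃) 1 one_pos _)
  obtain ⟨A₂, u', v', hA⟩ := distinguished_cocone_triangle₂ w'
  obtain ⟨a₂, hu, hv⟩ := complete_distinguished_triangle_morphism₂ T _ hT hA a₁ a₃ hw'
  obtain ⟨B₂, b₂, c₂, hT₂⟩ := distinguished_cocone_triangle a₂
  have hA₂S : A₂ ∈ triangClosure H := hS.2.2.2 _ hA hA₁S hA₃S
  have hB₂S : B₂ ∈ triangClosure H := hS.cone_mem hT₂ hY hA₂S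
  exact ⟨A₂, B₂, a₂, b₂, c₂, hA₂S,
    ⟨subset_retractClosure _ hA₂S, fun B hB j hj =>
      HomVanish.ext_right_shift hA j (hA₁.2 B hB j hj) (hA₃.2 B hB j hj)⟩,
    HasHeartCover.ext hadd hneg hA hA₁ hA₁c hA₃c, hB₂S,
    ⟨subset_retractClosure _ hB₂S, fun Y hY j hj =>
      HomVanish.cone_of_morphism hT hA hT₁ hT₂ hT₃ hu hv hw'
        (hB₁.2 Y hY j hj) (hB₃.2 Y hY j hj)⟩, hT₂⟩

lemma HasDecomp.of_iso {S : Set C} {X Y : C} (e : X ≅ Y) (hX : HasDecomp H S X) :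
    HasDecomp H S Y := by
  obtain ⟨A, B, f, g, h, hAS, hA, hAc, hBS, hB, hT⟩ := hX
  refine ⟨A, B, e.inv ≫ f, g, h ≫ e.hom⟦(1 : ℤ)⟧', hAS, hA, hAc, hBS, hB,
    isomorphic_distinguished _ hT _
      (Triangle.isoMk _ _ e.symm (Iso.refl _) (Iso.refl _) (Category.comp_id _)
        ((Category.comp_id _).trans (Category.id_comp _).symm) ?_)⟩
  change (h ≫ e.hom⟦(1 : ℤ)⟧') ≫ e.inv⟦(1 : ℤ)⟧' = 𝟙 B ≫ h
  rw [Category.assoc, ← Functor.map_comp, e.hom_inv_id, CategoryTheory.Functor.map_id, Category.comp_id,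
    Category.id_comp]

lemma hasDecomp_of_mem_triangClosure (hadd : AdditiveClass H) (hneg : Negative H) {X : C}
    (hX : X ∈ triangClosure H) : HasDecomp H (triangClosure H) X := by
  have hS := isTriangClosed_triangClosure H
  let D : Set C := {X | X ∈ triangClosure H ∧ ∀ n : ℤ, HasDecomp H (triangClosure H) (X⟦n⟧)}
  have hHD : H ⊆ D := fun X hX =>
    ⟨subset_triangClosure H hX, hasDecomp_shift_of_mem hadd hneg hX⟩
  have hD : IsTriangClosed D :=
    ⟨fun Z hZ => hHD (hadd.1 hZ),
      fun X Y e hX => ⟨hS.2.1 e hX.1, fun n => (hX.2 n).of_iso ((shiftFunctor C n).mapIso e)⟩,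
      fun X hX n => ⟨hS.2.2.1 hX.1 n, fun m =>
        (hX.2 (n + m)).of_iso ((shiftFunctorAdd' C n m _ rfl).app X)⟩,
      fun T hT h₁ h₃ => by
        have hY := hS.2.2.2 T hT h₁.1 h₃.1
        exact ⟨hY, fun n => HasDecomp.ext hadd hneg (Triangle.shift_distinguished T hT n)
          (hS.2.2.1 hY n) (h₁.2 n) (h₃.2 n)⟩⟩
  exact ((triangClosure_subset hD hHD hX).2 0).of_iso ((shiftFunctorZero C ℤ).app X)

lemma exists_homVanish_of_mem (hneg : Negative H) {X : C}
    (hX : X ∈ retractClosure (triangClosure H)) :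
    (∃ N : ℤ, ∀ B ∈ weightGE H, ∀ j, N < j → HomVanish B (X⟦j⟧)) ∧
      ∃ M : ℤ, ∀ Y ∈ H, ∀ j, M < j → HomVanish X (Y⟦j⟧) := by
  let D : Set C := {X | (∃ N : ℤ, ∀ B ∈ weightGE H, ∀ j, N < j → HomVanish B (X⟦j⟧)) ∧
      ∃ M : ℤ, ∀ Y ∈ H, ∀ j, M < j → HomVanish X (Y⟦j⟧)}
  have hretract {X Y : C} (h : IsRetractOf X Y) (hY : Y ∈ D) : X ∈ D := by
    obtain ⟨⟨N, hN⟩, M, hM⟩ := hY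
    exact ⟨⟨N, fun B hB j hj => (hN B hB j hj).of_retract_right (h.map (shiftFunctor C j))⟩,
      M, fun Z hZ j hj => (hM Z hZ j hj).of_retract_left h⟩
  have hD : IsTriangClosed D := by
    refine ⟨fun Z hZ => ⟨⟨0, fun B _ j _ f =>
        ((shiftFunctor C j).map_isZero hZ).eq_of_tgt _ _⟩, 0, fun Y _ j _ f => hZ.eq_of_src _ _⟩,
      fun X Y e hX => hretract ⟨e.inv, e.hom, e.inv_hom_id⟩ hX, ?_, ?_⟩
    · rintro X ⟨⟨N, hN⟩, M, hM⟩ n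
      exact ⟨⟨N - n, fun B hB j hj => (hN B hB (n + j) (by lia)).shift_right n j rfl⟩,
        M + n, fun Y hY j hj => (hM Y hY (j - n) (by lia)).shift_left n j (by ring)⟩
    · rintro T hT ⟨⟨N₁, hN₁⟩, M₁, hM₁⟩ ⟨⟨N₃, hN₃⟩, M₃, hM₃⟩
      exact ⟨⟨max N₁ N₃, fun B hB j hj => HomVanish.ext_right_shift hT j
          (hN₁ B hB j (by lia)) (hN₃ B hB j (by lia))⟩,
        max M₁ M₃, fun Y hY j hj => HomVanish.ext_left hT
          (hM₁ Y hY j (by lia)) (hM₃ Y hY j (by lia))⟩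
  have hHD : H ⊆ D := fun X hX =>
    ⟨⟨0, fun B hB j hj => hB.2 X hX j hj⟩, 0, fun Y hY j hj => hneg X hX Y hY j hj⟩
  obtain ⟨Y, hY, hXY⟩ := hX
  exact hretract hXY (triangClosure_subset hD hHD hY)

/-- If the connecting morphism of a distinguished triangle on `X ⊞ V ⟶ A` vanishes on `V`,
then `V` splits off: `X` fits in a triangle with the same cone and a retract of `A`. -/
lemma exists_distTriang_of_biprod {X V A B : C} {f : X ⊞ V ⟶ A} {g : A ⟶ B}
    {h : B ⟶ (X ⊞ V : C)⟦(1 : ℤ)⟧} (hT : Triangle.mk f g h ∈ distTriang C)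
    (hsnd : h ≫ (biprod.snd : X ⊞ V ⟶ V)⟦(1 : ℤ)⟧' = 0) :
    ∃ (A' : C) (f' : X ⟶ A') (g' : A' ⟶ B) (h' : B ⟶ X⟦(1 : ℤ)⟧),
      IsRetractOf A' A ∧ Triangle.mk f' g' h' ∈ distTriang C := by
  obtain ⟨h', hh'⟩ : ∃ h', h' = h ≫ (biprod.fst : X ⊞ V ⟶ X)⟦(1 : ℤ)⟧' := ⟨_, rfl⟩
  have hinl : h' ≫ (biprod.inl : X ⟶ X ⊞ V)⟦(1 : ℤ)⟧' = h := by
    have htot : (shiftFunctor C (1 : ℤ)).map (biprod.fst : X ⊞ V ⟶ X) ≫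
        (shiftFunctor C (1 : ℤ)).map biprod.inl +
        (shiftFunctor C (1 : ℤ)).map (biprod.snd : X ⊞ V ⟶ V) ≫
          (shiftFunctor C (1 : ℤ)).map biprod.inr = 𝟙 _ := by
      rw [← Functor.map_comp, ← Functor.map_comp, ← Functor.map_add, biprod.total,
        CategoryTheory.Functor.map_id]
    rw [← Category.comp_id h, ← htot, Preadditive.comp_add, ← Category.assoc,
      ← Category.assoc, hsnd, zero_comp, add_zero, hh']
  obtain ⟨A', f', g', hT'⟩ := distinguished_cocone_triangle₂ h'
  obtain ⟨i, hi₁, hi₂⟩ : ∃ i : A' ⟶ A, f' ≫ i = biprod.inl ≫ f ∧ g' ≫ 𝟙 B = i ≫ g :=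
    complete_distinguished_triangle_morphism₂ _ _ hT' hT
      (biprod.inl : X ⟶ X ⊞ V) (𝟙 B) (hinl.trans (Category.id_comp _).symm)
  obtain ⟨r, hr₁, hr₂⟩ : ∃ r : A ⟶ A', f ≫ r = biprod.fst ≫ f' ∧ g ≫ 𝟙 B = r ≫ g' :=
    complete_distinguished_triangle_morphism₂ _ _ hT hT'
      (biprod.fst : X ⊞ V ⟶ X) (𝟙 B) (hh'.symm.trans (Category.id_comp _).symm)
  have hiso : IsIso (i ≫ r) := by
    let φ : Triangle.mk f' g' h' ⟶ Triangle.mk f' g' h' :=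
      { hom₁ := 𝟙 X
        hom₂ := i ≫ r
        hom₃ := 𝟙 B
        comm₁ := by
          change f' ≫ i ≫ r = 𝟙 X ≫ f'
          rw [← Category.assoc, hi₁, Category.assoc, hr₁, biprod.inl_fst_assoc,
            Category.id_comp]
        comm₂ := by
          change g' ≫ 𝟙 B = (i ≫ r) ≫ g'
          rw [Category.assoc, ← hr₂, Category.comp_id, Category.comp_id, ← hi₂,
            Category.comp_id]
        comm₃ := by
          change h' ≫ (𝟙 X)⟦(1 : ℤ)⟧' = 𝟙 B ≫ h'
          rw [CategoryTheory.Functor.map_id, Category.comp_id, Category.id_comp] }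
    exact isIso₂_of_isIso₁₃ φ hT' hT' (inferInstanceAs (IsIso (𝟙 X)))
      (inferInstanceAs (IsIso (𝟙 B)))
  exact ⟨A', f', g', h', ⟨i, r ≫ inv (i ≫ r), by
    rw [← Category.assoc, IsIso.hom_inv_id]⟩, hT'⟩

lemma hasDecomp_of_mem (hadd : AdditiveClass H) (hneg : Negative H) {X : C}
    (hX : X ∈ retractClosure (triangClosure H)) :
    HasDecomp H (retractClosure (triangClosure H)) X := by
  obtain ⟨N, hN⟩ := (exists_homVanish_of_mem hneg hX).1
  obtain ⟨Y, hY, hXY⟩ := hX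
  obtain ⟨A, B, f, g, h, -, hA, hAc, -, hB, hT⟩ := hasDecomp_of_mem_triangClosure hadd hneg
    ((isTriangClosed_triangClosure H).biprod_shift_mem_of_retract hXY hY N.toNat)
  obtain ⟨A', f', g', h', hA', hT'⟩ := exists_distTriang_of_biprod hT
    ((hN B hB (2 * N.toNat + 1 + 1) (by lia)).shift_right _ 1 rfl _)
  exact ⟨A', B, f', g', h', retractClosure_of_retract hA' hA.1, weightLE_of_retract hA' hA,
    hAc.of_retract hA', hB.1, hB, hT'⟩

lemma isRetractOf_of_mor₃_eq_zero {T : Triangle C} (hT : T ∈ distTriang C)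
    (h : T.mor₃ = 0) : IsRetractOf T.obj₁ T.obj₂ := by
  have := T.mono₁ hT h
  have := isSplitMono_of_mono T.mor₁
  exact ⟨T.mor₁, retraction T.mor₁, IsSplitMono.id T.mor₁⟩

lemma weightLE_inter_weightGE (hadd : AdditiveClass H) (hneg : Negative H) :
    weightLE H ∩ weightGE H = retractClosure H := by
  refine Set.Subset.antisymm (fun X hX => ?_) fun X ⟨Y, hY, hXY⟩ =>
    ⟨weightLE_of_retract hXY (subset_weightLE hY),
      weightGE_of_retract hXY (subset_weightGE hneg hY)⟩
  obtain ⟨A, B, f, g, h, -, -, ⟨Y, hY, p, hp⟩, -, hB, hT⟩ := hasDecomp_of_mem hadd hneg hX.1.1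
  obtain ⟨i, r, hir⟩ : IsRetractOf X A :=
    isRetractOf_of_mor₃_eq_zero hT (hX.1.2 B hB 1 one_pos h)
  obtain ⟨k, hk⟩ := hp X hX.2 i
  exact ⟨Y, hY, k, p ≫ r, by rw [← Category.assoc, hk, hir]⟩

lemma isWeightStructureOn_weightLE_weightGE (hadd : AdditiveClass H) (hneg : Negative H) :
    IsWeightStructureOn (retractClosure (triangClosure H)) (weightLE H) (weightGE H) := by
  refine ⟨fun _ h => h.1, fun _ h => h.1, fun _ _ _ h hY => weightLE_of_retract h hY,
    fun _ _ _ h hY => weightGE_of_retract h hY, fun X Y hX hY b ⟨hb⟩ hbT => ⟨hbT, ?_⟩,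
    fun X Y hX hY b ⟨hb⟩ hbT => ⟨hbT, ?_⟩, fun _ hX => weightLE_shift hX zero_le_one,
    fun _ hX => weightGE_shift hX, fun X Y hX hY => hY.2 X hX 1 one_pos, fun X hX => ?_⟩
  · exact fun B hB j hj =>
      HomVanish.biprod_right_shift j (hX.2 B hB j hj) (hY.2 B hB j hj) b hb
  · exact fun Z hZ j hj => (hX.2 Z hZ j hj).biprod_left (hY.2 Z hZ j hj) b hb
  · obtain ⟨A, B, f, g, h, -, hA, -, -, hB, hT⟩ := hasDecomp_of_mem hadd hneg hX
    exact ⟨A, B, f, g, h, hA, hB, hT⟩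

lemma boundedOn_weightLE_weightGE (hneg : Negative H) :
    BoundedOn (retractClosure (triangClosure H)) (weightLE H) (weightGE H) := fun X hX => by
  obtain ⟨⟨N, hN⟩, M, hM⟩ := exists_homVanish_of_mem hneg hX
  have hshift := retractClosure_shift (isTriangClosed_triangClosure H) hX
  exact ⟨⟨N, hshift N, fun B hB j hj => (hN B hB (N + j) (by lia)).shift_right N j rfl⟩,
    -M, hshift _, fun Y hY j hj => (hM Y hY (j + M) (by lia)).shift_left (-M) j (by ring)⟩

/-- An object right orthogonal to the nonpositive shifts of `H` is right orthogonal to the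
objects of `weightGE H`. -/
lemma homVanish_of_mem_weightGE (hadd : AdditiveClass H) (hneg : Negative H) {A : C}
    (hA : ∀ Y ∈ H, ∀ j : ℤ, 0 < j → HomVanish Y (A⟦j⟧)) {B : C} (hB : B ∈ weightGE H)
    {j : ℤ} (hj : 0 < j) : HomVanish B (A⟦j⟧) := by
  have heart {X : C} (hX : X ∈ weightLE H ∩ weightGE H) {j : ℤ} (hj : 0 < j) :
      HomVanish X (A⟦j⟧) := by
    rw [weightLE_inter_weightGE hadd hneg] at hX
    obtain ⟨Y, hY, hXY⟩ := hX
    exact (hA Y hY j hj).of_retract_left hXY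
  have key (k : ℕ) : ∀ B ∈ weightGE H,
      (∀ X ∈ weightGE H, ∀ j : ℤ, (k : ℤ) < j → HomVanish X (B⟦j⟧)) →
      ∀ j : ℤ, 0 < j → HomVanish B (A⟦j⟧) := by
    induction k with
    | zero => exact fun B hB hk j hj => heart ⟨⟨hB.1, hk⟩, hB⟩ hj
    | succ k ih =>
      intro B hB hk j hj
      obtain ⟨A₀, B₀, f, g, h, -, hA₀, -, -, hB₀, hT⟩ := hasDecomp_of_mem hadd hneg hB.1
      have hA₀' : A₀ ∈ weightGE H := ⟨hA₀.1, fun Y hY i hi =>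
        HomVanish.ext_left hT (hB.2 Y hY i hi) (hB₀.2 Y hY i hi)⟩
      have hB₀A := ih B₀ hB₀ (fun X hX i hi =>
        HomVanish.ext_right_shift (rot_of_distTriang _ hT) i (hA₀.2 X hX i (by lia))
          ((hk X hX (1 + i) (by push_cast; lia)).shift_right 1 i rfl)) (j + 1) (by lia)
      exact HomVanish.ext_left (inv_rot_of_distTriang _ hT)
        (hB₀A.shift_left (-1) j (by ring)) (heart ⟨hA₀, hA₀'⟩ hj)
  obtain ⟨N, hN⟩ := (exists_homVanish_of_mem hneg hB.1).1
  exact key N.toNat B hB (fun X hX i hi => hN X hX i (by lia)) j hj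

lemma IsWeightStructureOn.eq_weightLE_weightGE (hadd : AdditiveClass H) (hneg : Negative H)
    {le ge : Set C} (hw : IsWeightStructureOn (retractClosure (triangClosure H)) le ge)
    (hH : H ⊆ le ∩ ge) : le = weightLE H ∧ ge = weightGE H := by
  obtain ⟨hleT, hgeT, hle, hge, -, -, hleS, hgeS, horth, hdec⟩ := hw
  have horth' (X : C) (hX : X ∈ ge) (n : ℕ) :
      ∀ Y ∈ le, HomVanish X (Y⟦(n + 1 : ℤ)⟧) := by
    induction n with
    | zero =>
      intro Y hY
      have h : HomVanish X (Y⟦(1 : ℤ)⟧) := horth hX hY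
      simpa using h
    | succ n ih =>
      exact fun Y hY => (ih _ (hleS hY)).unshift_right _ (by push_cast; ring)
  have horth'' {X Y : C} (hX : X ∈ ge) (hY : Y ∈ le) {j : ℤ} (hj : 0 < j) :
      HomVanish X (Y⟦j⟧) := by
    obtain ⟨n, rfl⟩ : ∃ n : ℕ, j = n + 1 := ⟨(j - 1).toNat, by lia⟩
    exact horth' X hX n Y hY
  have hge_le : ge ⊆ weightGE H := fun X hX =>
    ⟨hgeT hX, fun Y hY j hj => horth'' hX (hH hY).1 hj⟩
  have hle_le : le ⊆ weightLE H := fun X hX =>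
    ⟨hleT hX, fun B hB j hj => homVanish_of_mem_weightGE hadd hneg
      (fun Y hY i hi => horth'' (hH hY).2 hX hi) hB hj⟩
  refine ⟨hle_le.antisymm fun X hX => ?_, hge_le.antisymm fun X hX => ?_⟩
  · obtain ⟨A, B, f, g, h, hA, hB, hT⟩ := hdec X hX.1
    exact hle hX.1 (isRetractOf_of_mor₃_eq_zero hT (hX.2 B (hge_le hB) 1 one_pos h)) hA
  · obtain ⟨A, B, f, g, h, hA, hB, hT⟩ := hdec (X⟦(-1 : ℤ)⟧)
      (retractClosure_shift (isTriangClosed_triangClosure H) hX.1 _)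
    let e : X⟦(-1 : ℤ)⟧⟦(1 : ℤ)⟧ ≅ X := (shiftFunctorCompIsoId C (-1 : ℤ) 1 (by lia)).app X
    have hzero : HomVanish (X⟦(-1 : ℤ)⟧⟦(1 : ℤ)⟧) (A⟦(1 : ℤ)⟧) :=
      ((hle_le hA).2 X hX 1 one_pos).of_iso_left e
    obtain ⟨s, hs⟩ : ∃ s : X⟦(-1 : ℤ)⟧⟦(1 : ℤ)⟧ ⟶ B, 𝟙 _ = s ≫ h :=
      Triangle.coyoneda_exact₂ _ (rot_of_distTriang _ (rot_of_distTriang _ hT)) (𝟙 _) (hzero _)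
    exact hge hX.1 (IsRetractOf.trans ⟨e.inv, e.hom, e.inv_hom_id⟩ ⟨s, h, hs.symm⟩) hB

end

/-- Proposition 1.3.3(6): if `C` is idempotent complete and `H` is a negative
additive class of objects, then the Karoubi-closure `T` of `⟨H⟩` in `C` carries a
unique bounded weight structure such that `H ⊆ T^{w=0}`; its heart is the
Karoubi-closure of `H` in `C`. -/
theorem exists_unique_weightStructure_of_negative [IsIdempotentComplete C]
    (H : Set C) (hadd : AdditiveClass H) (hneg : Negative H) :
    ∃ le ge : Set C,
      IsWeightStructureOn (retractClosure (triangClosure H)) le ge ∧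
      BoundedOn (retractClosure (triangClosure H)) le ge ∧
      H ⊆ le ∩ ge ∧
      le ∩ ge = retractClosure H ∧
      (∀ le' ge' : Set C,
        IsWeightStructureOn (retractClosure (triangClosure H)) le' ge' →
        BoundedOn (retractClosure (triangClosure H)) le' ge' →
        H ⊆ le' ∩ ge' → le' = le ∧ ge' = ge) := by
  have hH : H ⊆ weightLE H ∩ weightGE H := fun X hX =>
    ⟨subset_weightLE hX, subset_weightGE hneg hX⟩
  exact ⟨weightLE H, weightGE H, isWeightStructureOn_weightLE_weightGE hadd hneg,
    boundedOn_weightLE_weightGE hneg, hH, weightLE_inter_weightGE hadd hneg,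
    fun _ _ hw _ hH' => hw.eq_weightLE_weightGE hadd hneg hH'⟩

end Paper
end

section
/- In the setting of the main weight structure lemma (D triangulated, weakly generated by an additive, negative set H of compact objects; an extension-stable class D ⊆ Obj D with Obj H ∪ D[1] ⊆ D admitting small coproducts; C ⊆ D an idempotent complete triangulated subcategory of compact objects of D with H ⊆ C, bounded with respect to H), let w be the bounded weight structure on C whose heart is the Karoubi-closure of H in C. Then for any X ∈ Obj C and integers j ≤ q: if Hom(A, X[i]) = 0 for all A ∈ Obj H and i > q, and Hom(X[i], A) = 0 for all A ∈ Obj H and i < j, then X ∈ C^{[j,q]}. -/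
open CategoryTheory CategoryTheory.Limits CategoryTheory.Pretriangulated

universe v u

namespace Paper

variable (C : Type u) [Category.{v} C] [HasZeroObject C] [Preadditive C] [HasShift C ℤ]
  [∀ n : ℤ, (shiftFunctor C n).Additive] [Pretriangulated C]

variable {C}

open scoped Classical in
/-- An object `X` is compact if `Hom(X,−)` respects all small coproducts that
exist in the category: the canonical map `⊕ᵢ Hom(X, fᵢ) → Hom(X, ∐ᵢ fᵢ)` is
bijective. -/
def IsCompactObj (X : C) : Prop :=
  ∀ ⦃ι : Type v⦄ (f : ι → C) (c : Cofan f), Nonempty (IsColimit c) →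
    Function.Bijective fun d : Π₀ i : ι, (X ⟶ f i) =>
      d.sum fun i (g : X ⟶ f i) => g ≫ c.inj i

/-- A class of objects weakly generates `C`: if all shifts of all its objects have
no nonzero morphisms to `X`, then `X = 0`. -/
def WeaklyGenerates (H : Set C) : Prop :=
  ∀ X : C, (∀ A ∈ H, ∀ j : ℤ, ∀ f : A⟦j⟧ ⟶ X, f = 0) → IsZero X

/-- All small coproducts of families of objects of `D` exist in `C` and lie in `D`. -/
def CoprodClosedClass (D : Set C) : Prop :=
  ∀ ⦃ι : Type v⦄ (f : ι → C), (∀ i, f i ∈ D) →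
    ∃ c : Cofan f, Nonempty (IsColimit c) ∧ c.pt ∈ D

/-- The full subcategory on the class `T` is idempotent complete: every idempotent
endomorphism of an object of `T` splits through an object of `T`. -/
def IdemCompleteOn (T : Set C) : Prop :=
  ∀ X ∈ T, ∀ p : X ⟶ X, p ≫ p = p →
    ∃ Y ∈ T, ∃ (i : Y ⟶ X) (r : X ⟶ Y), i ≫ r = 𝟙 Y ∧ r ≫ i = p

/-- The subcategory on the class `T` is bounded with respect to `H`:
every `X ∈ T` satisfies the orthogonality conditions `(3)` for some `j_X, q_X`. -/
def BoundedWrtOn (T H : Set C) : Prop :=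
  ∀ X ∈ T, ∃ j q : ℤ,
    (∀ A ∈ H, ∀ i : ℤ, q < i → ∀ f : A ⟶ X⟦i⟧, f = 0) ∧
    (∀ A ∈ H, ∀ i : ℤ, i < j → ∀ f : X⟦i⟧ ⟶ A, f = 0)

/-- There are no nonzero morphisms from `X` to `Y`. -/
def HomZero {E : Type u} [Category.{v} E] [Preadditive E] (X Y : E) : Prop := ∀ f : X ⟶ Y, f = 0

lemma HomZero.of_retract_left {E : Type u} [Category.{v} E] [Preadditive E] {X X' Y : E}
    (h : HomZero X' Y) (hr : IsRetractOf X X') :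
    HomZero X Y := by
  obtain ⟨i, r, hir⟩ := hr
  intro f
  rw [← Category.id_comp f, ← hir, Category.assoc, h (r ≫ f), comp_zero]

lemma HomZero.of_retract_right {E : Type u} [Category.{v} E] [Preadditive E] {X Y Y' : E}
    (h : HomZero X Y') (hr : IsRetractOf Y Y') :
    HomZero X Y := by
  obtain ⟨i, r, hir⟩ := hr
  intro f
  rw [← Category.comp_id f, ← hir, ← Category.assoc, h (f ≫ i), zero_comp]

lemma IsRetractOf.of_iso {E : Type u} [Category.{v} E] {X Y : E} (e : X ≅ Y) : IsRetractOf X Y :=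
  ⟨e.hom, e.inv, e.hom_inv_id⟩

lemma HomZero.of_shift {E : Type u} [Category.{v} E] [Preadditive E] [HasShift E ℤ]
    [∀ n : ℤ, (shiftFunctor E n).Additive] {X Y : E} (n : ℤ)
    (h : HomZero (X⟦n⟧) (Y⟦n⟧)) : HomZero X Y :=
  fun f => (shiftFunctor E n).map_injective (by rw [h (f⟦n⟧'), Functor.map_zero])

/-- `X⟦a⟧⟦b⟧` is a retract of `X⟦c⟧` when `a + b = c`. -/
lemma isRetractOf_shift_shift {E : Type u} [Category.{v} E] [HasShift E ℤ] (X : E)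
    {a b c : ℤ} (h : a + b = c) :
    IsRetractOf (X⟦a⟧⟦b⟧) (X⟦c⟧) :=
  .of_iso ((shiftFunctorAdd' E a b c h).app X).symm

/-- `X⟦c⟧` is a retract of `X⟦a⟧⟦b⟧` when `a + b = c`. -/
lemma isRetractOf_shift_add {E : Type u} [Category.{v} E] [HasShift E ℤ] (X : E)
    {a b c : ℤ} (h : a + b = c) :
    IsRetractOf (X⟦c⟧) (X⟦a⟧⟦b⟧) :=
  .of_iso ((shiftFunctorAdd' E a b c h).app X)

lemma isRetractOf_shift_shift_zero {E : Type u} [Category.{v} E] [HasShift E ℤ] (X : E)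
    {a b : ℤ} (h : a + b = 0) :
    IsRetractOf (X⟦a⟧⟦b⟧) X :=
  .of_iso ((shiftFunctorCompIsoId E a b h).app X)

lemma isRetractOf_self_shift_shift {E : Type u} [Category.{v} E] [HasShift E ℤ] (X : E)
    {a b : ℤ} (h : a + b = 0) :
    IsRetractOf X (X⟦a⟧⟦b⟧) :=
  .of_iso ((shiftFunctorCompIsoId E a b h).app X).symm

lemma HomZero.shift {X Y : C} (h : HomZero X Y) (n : ℤ) : HomZero (X⟦n⟧) (Y⟦n⟧) :=
  .of_shift (-n) ((h.of_retract_left (isRetractOf_shift_shift_zero X (by simp))).of_retract_right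
    (isRetractOf_shift_shift_zero Y (by simp)))

lemma HomZero.to_obj₂ {X : C} {t : Triangle C} (ht : t ∈ distTriang C)
    (h₁ : HomZero X t.obj₁) (h₃ : HomZero X t.obj₃) : HomZero X t.obj₂ := by
  intro f
  obtain ⟨g, rfl⟩ := Triangle.coyoneda_exact₂ t ht f (h₃ _)
  rw [h₁ g, zero_comp]

lemma HomZero.from_obj₂ {Y : C} {t : Triangle C} (ht : t ∈ distTriang C)
    (h₁ : HomZero t.obj₁ Y) (h₃ : HomZero t.obj₃ Y) : HomZero t.obj₂ Y := by
  intro f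
  obtain ⟨g, rfl⟩ := Triangle.yoneda_exact₂ t ht f (h₁ _)
  rw [h₃ g, comp_zero]

namespace IsWeightStructureOn

variable {T le ge : Set C}

lemma le_subset (hw : IsWeightStructureOn T le ge) : le ⊆ T := hw.1

lemma ge_subset (hw : IsWeightStructureOn T le ge) : ge ⊆ T := hw.2.1

lemma le_retract (hw : IsWeightStructureOn T le ge) {X Y : C} (hX : X ∈ T)
    (h : IsRetractOf X Y) (hY : Y ∈ le) : X ∈ le := hw.2.2.1 hX h hY

lemma ge_retract (hw : IsWeightStructureOn T le ge) {X Y : C} (hX : X ∈ T)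
    (h : IsRetractOf X Y) (hY : Y ∈ ge) : X ∈ ge := hw.2.2.2.1 hX h hY

lemma le_shift_one (hw : IsWeightStructureOn T le ge) {X : C} (hX : X ∈ le) :
    X⟦(1 : ℤ)⟧ ∈ le := hw.2.2.2.2.2.2.1 hX

lemma ge_shift_neg_one (hw : IsWeightStructureOn T le ge) {X : C} (hX : X ∈ ge) :
    X⟦(-1 : ℤ)⟧ ∈ ge := hw.2.2.2.2.2.2.2.1 hX

lemma homZero (hw : IsWeightStructureOn T le ge) {X Y : C} (hX : X ∈ ge) (hY : Y ∈ le) :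
    HomZero X (Y⟦(1 : ℤ)⟧) := hw.2.2.2.2.2.2.2.2.1 hX hY

lemma exists_decomp (hw : IsWeightStructureOn T le ge) {X : C} (hX : X ∈ T) :
    ∃ (A B : C) (f : X ⟶ A) (g : A ⟶ B) (h : B ⟶ X⟦(1 : ℤ)⟧),
      A ∈ le ∧ B ∈ ge ∧ Triangle.mk f g h ∈ distTriang C := hw.2.2.2.2.2.2.2.2.2 X hX

lemma le_shift_natCast (hw : IsWeightStructureOn T le ge) (hT : IsTriangClosed T) {X : C}
    (hX : X ∈ le) (n : ℕ) : X⟦(n : ℤ)⟧ ∈ le := by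
  have hXT := hw.le_subset hX
  induction n with
  | zero => exact hw.le_retract (hT.2.2.1 hXT _) (.of_iso ((shiftFunctorZero C ℤ).app X)) hX
  | succ n ih =>
    exact hw.le_retract (hT.2.2.1 hXT _) (isRetractOf_shift_add X (by simp)) (hw.le_shift_one ih)

lemma ge_shift_neg_natCast (hw : IsWeightStructureOn T le ge) (hT : IsTriangClosed T) {X : C}
    (hX : X ∈ ge) (n : ℕ) : X⟦(-n : ℤ)⟧ ∈ ge := by
  have hXT := hw.ge_subset hX
  induction n with
  | zero =>
    exact hw.ge_retract (hT.2.2.1 hXT _)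
      (.of_iso ((shiftFunctorZero' C (-((0 : ℕ) : ℤ)) (by simp)).app X)) hX
  | succ n ih =>
    exact hw.ge_retract (hT.2.2.1 hXT _) (isRetractOf_shift_add X (by push_cast; ring))
      (hw.ge_shift_neg_one ih)

lemma mem_le_of_homZero (hw : IsWeightStructureOn T le ge) {X : C} (hX : X ∈ T)
    (h : ∀ G ∈ ge, HomZero G (X⟦(1 : ℤ)⟧)) : X ∈ le := by
  obtain ⟨A, B, f, g, k, hA, hB, ht⟩ := hw.exists_decomp hX
  have hinv := inv_rot_of_distTriang _ ht
  obtain ⟨r, hr⟩ := Triangle.yoneda_exact₂ _ hinv (𝟙 X)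
    ((((h B hB).shift (-1)).of_retract_right (isRetractOf_self_shift_shift X (by simp))) _)
  exact hw.le_retract hX ⟨f, r, hr.symm⟩ hA

lemma mem_ge_of_homZero (hw : IsWeightStructureOn T le ge) (hT : IsTriangClosed T) {X : C}
    (hX : X ∈ T) (h : ∀ L ∈ le, HomZero X (L⟦(1 : ℤ)⟧)) : X ∈ ge := by
  obtain ⟨A, B, f, g, k, hA, hB, ht⟩ := hw.exists_decomp (hT.2.2.1 hX (-1))
  have hretr : IsRetractOf (X⟦(-1 : ℤ)⟧⟦(1 : ℤ)⟧) X := isRetractOf_shift_shift_zero X (by simp)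
  obtain ⟨s, hs⟩ := Triangle.coyoneda_exact₂ _
    (rot_of_distTriang _ (rot_of_distTriang _ ht)) (𝟙 (X⟦(-1 : ℤ)⟧⟦(1 : ℤ)⟧))
    (((h A hA).of_retract_left hretr) _)
  have hge := hw.ge_retract (hT.2.2.1 (hT.2.2.1 hX (-1)) 1) ⟨s, k, hs.symm⟩ hB
  exact hw.ge_retract hX (isRetractOf_self_shift_shift X (by simp)) hge

lemma le_ext (hw : IsWeightStructureOn T le ge) (hT : IsTriangClosed T) :
    ExtStable C le := fun t ht h₁ h₃ =>
  hw.mem_le_of_homZero (hT.2.2.2 t ht (hw.le_subset h₁) (hw.le_subset h₃)) fun _ hG =>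
    HomZero.to_obj₂ (Triangle.shift_distinguished t ht 1) (hw.homZero hG h₁) (hw.homZero hG h₃)

lemma ge_ext (hw : IsWeightStructureOn T le ge) (hT : IsTriangClosed T) :
    ExtStable C ge := fun t ht h₁ h₃ =>
  hw.mem_ge_of_homZero hT (hT.2.2.2 t ht (hw.ge_subset h₁) (hw.ge_subset h₃)) fun _ hL =>
    HomZero.from_obj₂ ht (hw.homZero h₁ hL) (hw.homZero h₃ hL)

/-- An object orthogonal to the positive shifts of the heart is orthogonal to the positive shifts
of every bounded object of `le`. -/
lemma homZero_le_of_heart (hw : IsWeightStructureOn T le ge) (hT : IsTriangClosed T) {Y : C}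
    (hY : ∀ A ∈ le ∩ ge, ∀ m : ℤ, 0 < m → HomZero Y (A⟦m⟧)) (n : ℕ) :
    ∀ L ∈ le, L⟦(-n : ℤ)⟧ ∈ ge → ∀ m : ℤ, 0 < m → HomZero Y (L⟦m⟧) := by
  induction n with
  | zero =>
    intro L hL hLn
    exact hY L ⟨hL, hw.ge_retract (hw.le_subset hL)
      (.of_iso ((shiftFunctorZero' C (-((0 : ℕ) : ℤ)) (by simp)).app L).symm) hLn⟩
  | succ n ih =>
    intro L hL hLn m hm
    have hLT := hw.le_subset hL
    obtain ⟨A, B, f, g, k, hA, hB, ht⟩ := hw.exists_decomp (hT.2.2.1 hLT (-1))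
    have ht' := rot_of_distTriang _ ht
    have hBle : B ∈ le := hw.le_ext hT _ ht' hA
      (hw.le_retract (hT.2.2.1 (hT.2.2.1 hLT (-1)) 1)
        (isRetractOf_shift_shift_zero L (by simp)) hL)
    have hAn : A⟦(-n : ℤ)⟧ ∈ ge := hw.ge_ext hT _ (Triangle.shift_distinguished _ ht (-n))
      (hw.ge_retract (hT.2.2.1 (hT.2.2.1 hLT (-1)) _)
        (isRetractOf_shift_shift L (by push_cast; ring)) hLn)
      (hw.ge_shift_neg_natCast hT hB n)
    have hshift : HomZero Y (L⟦(-1 : ℤ)⟧⟦(1 : ℤ)⟧⟦m⟧) := HomZero.to_obj₂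
      (Triangle.shift_distinguished _ (rot_of_distTriang _ ht') m) (hY B ⟨hBle, hB⟩ m hm)
      ((ih A hA hAn (1 + m) (by omega)).of_retract_right (isRetractOf_shift_shift A rfl))
    exact hshift.of_retract_right
      (.of_iso ((shiftFunctor C m).mapIso
        ((shiftFunctorCompIsoId C (-1 : ℤ) 1 (by simp)).app L).symm))

/-- An object whose positive shifts are right orthogonal to the heart has positive shifts right
orthogonal to every bounded object of `ge`. -/
lemma homZero_ge_of_heart (hw : IsWeightStructureOn T le ge) (hT : IsTriangClosed T) {Y : C}
    (hY : ∀ A ∈ le ∩ ge, ∀ m : ℤ, 0 < m → HomZero A (Y⟦m⟧)) (n : ℕ) :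
    ∀ G ∈ ge, G⟦(n : ℤ)⟧ ∈ le → ∀ m : ℤ, 0 < m → HomZero G (Y⟦m⟧) := by
  induction n with
  | zero =>
    intro G hG hGn
    exact hY G ⟨hw.le_retract (hw.ge_subset hG)
      (.of_iso ((shiftFunctorZero C ℤ).app G).symm) hGn, hG⟩
  | succ n ih =>
    intro G hG hGn m hm
    have hGT := hw.ge_subset hG
    obtain ⟨A, B, f, g, k, hA, hB, ht⟩ := hw.exists_decomp hGT
    have hAge : A ∈ ge := hw.ge_ext hT _ ht hG hB
    have hBn : B⟦(n : ℤ)⟧ ∈ le :=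
      hw.le_ext hT _ (Triangle.shift_distinguished _ (rot_of_distTriang _ ht) n)
        (hw.le_shift_natCast hT hA n)
        (hw.le_retract (hT.2.2.1 (hT.2.2.1 hGT 1) _)
          (isRetractOf_shift_shift G (by push_cast; ring)) hGn)
    refine HomZero.from_obj₂ (inv_rot_of_distTriang _ ht) ?_ (hY A ⟨hA, hAge⟩ m hm)
    exact ((ih B hB hBn (m + 1) (by omega)).shift (-1)).of_retract_right
      (isRetractOf_shift_add Y (by ring))

lemma mem_ge_of_heart (hw : IsWeightStructureOn T le ge) (hT : IsTriangClosed T)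
    (hwb : BoundedOn T le ge) {Y : C} (hYT : Y ∈ T)
    (hY : ∀ A ∈ le ∩ ge, ∀ m : ℤ, 0 < m → HomZero Y (A⟦m⟧)) : Y ∈ ge := by
  refine hw.mem_ge_of_homZero hT hYT fun L hL => ?_
  have hLT := hw.le_subset hL
  obtain ⟨i, hi⟩ := (hwb L hLT).2
  refine hw.homZero_le_of_heart hT hY i.natAbs L hL ?_ 1 one_pos
  exact hw.ge_retract (hT.2.2.1 hLT _) (isRetractOf_shift_add L (by omega))
    (hw.ge_shift_neg_natCast hT hi (i + i.natAbs).toNat)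

lemma mem_le_of_heart (hw : IsWeightStructureOn T le ge) (hT : IsTriangClosed T)
    (hwb : BoundedOn T le ge) {Y : C} (hYT : Y ∈ T)
    (hY : ∀ A ∈ le ∩ ge, ∀ m : ℤ, 0 < m → HomZero A (Y⟦m⟧)) : Y ∈ le := by
  refine hw.mem_le_of_homZero hYT fun G hG => ?_
  have hGT := hw.ge_subset hG
  obtain ⟨i, hi⟩ := (hwb G hGT).1
  refine hw.homZero_ge_of_heart hT hY i.natAbs G hG ?_ 1 one_pos
  exact hw.le_retract (hT.2.2.1 hGT _) (isRetractOf_shift_add G (by omega))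
    (hw.le_shift_natCast hT hi (i.natAbs - i).toNat)

end IsWeightStructureOn

/-- Proposition 1.4.1(3): in the setting of the 'main weight structure lemma', let
`(le, ge)` be the bounded weight structure on `T` whose heart is the
Karoubi-closure of `H`.  If `X ∈ T` satisfies the orthogonality conditions `(3)`
with bounds `j ≤ q`, then `X ∈ C^{[j,q]}`, i.e. `X⟦j⟧ ∈ ge` and `X⟦q⟧ ∈ le`. -/
theorem mem_interval_of_orthogonality (H T : Set C)
    (hcpt : ∀ X ∈ H, IsCompactObj X)
    (hadd : AdditiveClass H) (hneg : Negative H) (hgen : WeaklyGenerates H)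
    (D : Set C) (hext : ExtStable C D) (hHD : H ⊆ D)
    (hshift : ∀ X ∈ D, X⟦(1 : ℤ)⟧ ∈ D) (hcoprod : CoprodClosedClass D)
    (hT : IsTriangClosed T) (hTidem : IdemCompleteOn T)
    (hTcpt : ∀ X ∈ T, IsCompactObj X) (hHT : H ⊆ T)
    (hbdd : BoundedWrtOn T H)
    (le ge : Set C)
    (hw : IsWeightStructureOn T le ge) (hwb : BoundedOn T le ge)
    (hheart : le ∩ ge = T ∩ retractClosure H) :
    ∀ X ∈ T, ∀ j q : ℤ, j ≤ q →
      (∀ A ∈ H, ∀ i : ℤ, q < i → ∀ f : A ⟶ X⟦i⟧, f = 0) →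
      (∀ A ∈ H, ∀ i : ℤ, i < j → ∀ f : X⟦i⟧ ⟶ A, f = 0) →
      X⟦j⟧ ∈ ge ∧ X⟦q⟧ ∈ le := by
  intro X hX j q _ hq hj
  refine ⟨hw.mem_ge_of_heart hT hwb (hT.2.2.1 hX j) fun A hA m hm => ?_,
    hw.mem_le_of_heart hT hwb (hT.2.2.1 hX q) fun A hA m hm => ?_⟩
  · rw [hheart] at hA
    obtain ⟨-, B, hB, hr⟩ := hA
    have hXB : HomZero (X⟦j - m⟧) B := hj B hB (j - m) (by omega)
    exact ((hXB.of_retract_right hr).shift m).of_retract_left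
      (isRetractOf_shift_add X (by ring))
  · rw [hheart] at hA
    obtain ⟨-, B, hB, hr⟩ := hA
    have hBX : HomZero B (X⟦q + m⟧) := hq B hB (q + m) (by omega)
    exact (hBX.of_retract_left hr).of_retract_right (isRetractOf_shift_shift X rfl)

end Paper
end
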